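/- Let (v,p) be a smooth axisymmetric solution with no swirl of the steady Navier–Stokes equations on the periodic slab domain ℝ² × S¹ (i.e., (v·∇)v + ∇p = Δv, ∇·v = 0 in all of ℝ³, with v 2π-periodic in x₃), satisfying ∫_{ℝ²×S¹} |∇v(x)|^q dx < ∞ for some q ∈ [2,∞). Then v is a constant vector. -/

import Mathlib

open MeasureTheory Real Set Filter Topology

noncomputable section

/-- Three-dimensional Euclidean space. -/
abbrev E3 := EuclideanSpace ℝ (Fin 3)

/-- The distance to the `x₃`-axis, `r = √(x₁² + x₂²)`. -/
def rr (x : E3) : ℝ := Real.sqrt ((x 0) ^ 2 + (x 1) ^ 2)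

/-- Partial derivative of `g : ℝ³ → ℝ` in the `i`-th coordinate direction. -/
def pd (i : Fin 3) (g : E3 → ℝ) (x : E3) : ℝ := fderiv ℝ g x (EuclideanSpace.single i 1)

/-- Partial derivative in the first (radial) variable of a function of `(r,z)`. -/
def dr (f : ℝ → ℝ → ℝ) (r z : ℝ) : ℝ := deriv (fun s => f s z) r

/-- Partial derivative in the second (vertical) variable of a function of `(r,z)`. -/
def dzz (f : ℝ → ℝ → ℝ) (r z : ℝ) : ℝ := deriv (fun t => f r t) z

/-- The azimuthal vorticity `ω^θ = ∂_z v^r − ∂_r v^z` of an axisymmetric vector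
field without swirl, as a function of `(r,z)`. -/
def omTheta (vr vz : ℝ → ℝ → ℝ) (r z : ℝ) : ℝ := dzz vr r z - dr vz r z

/-- The rescaled azimuthal vorticity `Ω = ω^θ / r`. -/
def Om (vr vz : ℝ → ℝ → ℝ) (r z : ℝ) : ℝ := omTheta vr vz r z / r

/-- The squared Frobenius norm `|∇v|² = ∑ᵢⱼ (∂ᵢ vⱼ)²` of the gradient of a
vector field `v : ℝ³ → ℝ³`. -/
def gradSq3 (v : E3 → E3) (x : E3) : ℝ := ∑ i, ∑ j, (pd i (fun y => v y j) x) ^ 2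


/-- `v, p, vr, vz` constitute a smooth axisymmetric solution, without swirl, of the
steady Navier–Stokes equations in the periodic (in `x₃`, with period `2π`) slab
domain `ℝ² × S¹`, i.e. in all of `ℝ³` with `2π`-periodicity in `x₃`; the functions
`vr, vz` of `(r,z)` are the cylindrical components of `v`. -/
structure AxisymNoSwirlNSWholeSlab (v : E3 → E3) (p : E3 → ℝ)
    (vr vz : ℝ → ℝ → ℝ) : Prop where
  smooth_v : ContDiff ℝ (⊤ : ℕ∞) v
  smooth_p : ContDiff ℝ (⊤ : ℕ∞) p
  periodic : ∀ x : E3, v (x + (2 * π) • EuclideanSpace.single (2 : Fin 3) (1 : ℝ)) = v x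
  axisym_no_swirl : ∀ x : E3,
    v x 0 = vr (rr x) (x 2) * (x 0 / rr x) ∧
    v x 1 = vr (rr x) (x 2) * (x 1 / rr x) ∧
    v x 2 = vz (rr x) (x 2)
  momentum : ∀ x : E3, ∀ j : Fin 3,
    (∑ i, v x i * pd i (fun y => v y j) x) + pd j p x
      = ∑ i, pd i (pd i (fun y => v y j)) x
  incompressible : ∀ x : E3, (∑ i, pd i (fun y => v y i) x) = 0


/-! ### Calculus of partial derivatives -/

@[fun_prop]
theorem ContDiff.pd {f : E3 → ℝ} (hf : ContDiff ℝ (⊤ : ℕ∞) f) (i : Fin 3) :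
    ContDiff ℝ (⊤ : ℕ∞) (pd i f) := by
  unfold _root_.pd
  exact (hf.fderiv_right (m := (⊤ : ℕ∞)) (by simp)).clm_apply contDiff_const

theorem ContDiff.differentiable_top {f : E3 → ℝ} (hf : ContDiff ℝ (⊤ : ℕ∞) f) :
    Differentiable ℝ f :=
  hf.differentiable (by simp)

theorem pd_add {f g : E3 → ℝ} (hf : ContDiff ℝ (⊤ : ℕ∞) f) (hg : ContDiff ℝ (⊤ : ℕ∞) g)
    (i : Fin 3) (x : E3) : pd i (fun y => f y + g y) x = pd i f x + pd i g x := by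
  unfold pd
  rw [fderiv_fun_add (hf.differentiable_top x) (hg.differentiable_top x)]
  rfl

theorem pd_sub {f g : E3 → ℝ} (hf : ContDiff ℝ (⊤ : ℕ∞) f) (hg : ContDiff ℝ (⊤ : ℕ∞) g)
    (i : Fin 3) (x : E3) : pd i (fun y => f y - g y) x = pd i f x - pd i g x := by
  unfold pd
  rw [fderiv_fun_sub (hf.differentiable_top x) (hg.differentiable_top x)]
  rfl

theorem pd_mul {f g : E3 → ℝ} (hf : ContDiff ℝ (⊤ : ℕ∞) f) (hg : ContDiff ℝ (⊤ : ℕ∞) g)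
    (i : Fin 3) (x : E3) : pd i (fun y => f y * g y) x = pd i f x * g x + f x * pd i g x := by
  unfold pd
  rw [fderiv_fun_mul (hf.differentiable_top x) (hg.differentiable_top x)]
  simp only [_root_.add_apply, _root_.smul_apply, smul_eq_mul]
  ring

theorem pd_neg (f : E3 → ℝ) (i : Fin 3) (x : E3) : pd i (fun y => -f y) x = -pd i f x := by
  unfold pd
  rw [fderiv_fun_neg]
  rfl

theorem pd_const (c : ℝ) (i : Fin 3) (x : E3) : pd i (fun _ => c) x = 0 := by
  simp [pd]

theorem pd_coord (i j : Fin 3) (x : E3) : pd i (fun y => y j) x = if j = i then 1 else 0 := by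
  have h : fderiv ℝ (fun y : E3 => y j) x = EuclideanSpace.proj j :=
    (EuclideanSpace.proj j : E3 →L[ℝ] ℝ).hasFDerivAt.fderiv
  simp [pd, h]

theorem pd_comm {f : E3 → ℝ} (hf : ContDiff ℝ (⊤ : ℕ∞) f) (i j : Fin 3) (x : E3) :
    pd i (pd j f) x = pd j (pd i f) x := by
  have key : ∀ i j : Fin 3, pd i (pd j f) x =
      fderiv ℝ (fderiv ℝ f) x (EuclideanSpace.single i 1) (EuclideanSpace.single j 1) := by
    intro i j
    have hd : DifferentiableAt ℝ (fderiv ℝ f) x :=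
      (hf.fderiv_right (m := (⊤ : ℕ∞)) (by simp)).differentiable (by simp) x
    change fderiv ℝ (fun y => fderiv ℝ f y (EuclideanSpace.single j 1)) x _ = _
    rw [fderiv_clm_apply hd (differentiableAt_const _)]
    simp
  rw [key, key]
  exact (hf.contDiffAt.isSymmSndFDerivAt (by
    rw [minSmoothness_of_isRCLikeNormedField]
    exact WithTop.coe_le_coe.2 (le_top : (2 : ℕ∞) ≤ ⊤))).eq _ _

/-- The point of the meridian half plane `x₂ = 0` with coordinates `(r, z)`. -/
def hp (r z : ℝ) : E3 := r • EuclideanSpace.single 0 1 + z • EuclideanSpace.single 2 1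

@[simp] theorem hp_zero (r z : ℝ) : hp r z 0 = r := by simp [hp]
@[simp] theorem hp_one (r z : ℝ) : hp r z 1 = 0 := by simp [hp]
@[simp] theorem hp_two (r z : ℝ) : hp r z 2 = z := by simp [hp]

@[fun_prop]
theorem continuous_hp {X : Type*} [TopologicalSpace X] {f g : X → ℝ} (hf : Continuous f)
    (hg : Continuous g) : Continuous fun x => hp (f x) (g x) := by
  unfold hp
  fun_prop

theorem hasDerivAt_hp_left {f : E3 → ℝ} (hf : ContDiff ℝ (⊤ : ℕ∞) f) (r z : ℝ) :
    HasDerivAt (fun s => f (hp s z)) (pd 0 f (hp r z)) r := by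
  have h : HasDerivAt (fun s => hp s z) (EuclideanSpace.single 0 1) r := by
    have := ((hasDerivAt_id r).smul_const (EuclideanSpace.single 0 1 : E3)).add_const
      (z • EuclideanSpace.single 2 1 : E3)
    rwa [one_smul] at this
  exact (hf.differentiable_top (hp r z)).hasFDerivAt.comp_hasDerivAt r h

theorem hasDerivAt_hp_right {f : E3 → ℝ} (hf : ContDiff ℝ (⊤ : ℕ∞) f) (r z : ℝ) :
    HasDerivAt (fun s => f (hp r s)) (pd 2 f (hp r z)) z := by
  have h : HasDerivAt (fun s => hp r s) (EuclideanSpace.single 2 1) z := by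
    have := ((hasDerivAt_id z).smul_const (EuclideanSpace.single 2 1 : E3)).const_add
      (r • EuclideanSpace.single 0 1 : E3)
    rwa [one_smul] at this
  exact (hf.differentiable_top (hp r z)).hasFDerivAt.comp_hasDerivAt z h

/-- Differentiation of an identity that holds on the part `0 < r` of the half plane. -/
theorem pd_zero_of_eq_zero {f : E3 → ℝ} (hf : ContDiff ℝ (⊤ : ℕ∞) f)
    (h : ∀ r z, 0 < r → f (hp r z) = 0) {r z : ℝ} (hr : 0 < r) : pd 0 f (hp r z) = 0 := by
  have h1 : (fun s => f (hp s z)) =ᶠ[𝓝 r] fun _ => 0 := by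
    filter_upwards [lt_mem_nhds hr] with s hs using h s z hs
  exact (hasDerivAt_hp_left hf r z).unique ((hasDerivAt_const r (0 : ℝ)).congr_of_eventuallyEq h1)

theorem pd_two_of_eq_zero {f : E3 → ℝ} (hf : ContDiff ℝ (⊤ : ℕ∞) f) {r : ℝ}
    (h : ∀ z, f (hp r z) = 0) (z : ℝ) : pd 2 f (hp r z) = 0 := by
  have h1 : (fun s => f (hp r s)) = fun _ => 0 := funext h
  exact (hasDerivAt_hp_right hf r z).unique (h1 ▸ hasDerivAt_const z (0 : ℝ))

/-- The integral of `f` over a period in `z`, as a function of `r`. -/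
def zint (f : E3 → ℝ) (r : ℝ) : ℝ := ∫ z in (-π)..π, f (hp r z)

theorem continuous_zint {f : E3 → ℝ} (hf : Continuous f) : Continuous (zint f) := by
  unfold zint
  refine intervalIntegral.continuous_parametric_intervalIntegral_of_continuous' ?_ _ _
  have : Continuous fun p : ℝ × ℝ => f (hp p.1 p.2) := by fun_prop
  exact this

theorem intervalIntegrable_hp {f : E3 → ℝ} (hf : Continuous f) (r a b : ℝ) :
    IntervalIntegrable (fun z => f (hp r z)) volume a b :=
  Continuous.intervalIntegrable (by fun_prop) _ _

theorem hasDerivAt_zint {f : E3 → ℝ} (hf : ContDiff ℝ (⊤ : ℕ∞) f) (r : ℝ) :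
    HasDerivAt (zint f) (zint (pd 0 f) r) r := by
  have hc : Continuous fun p : ℝ × ℝ => pd 0 f (hp p.1 p.2) := by
    have := (hf.pd 0).continuous
    fun_prop
  obtain ⟨C, hC⟩ := ((isCompact_Icc (a := r - 1) (b := r + 1)).prod
    (isCompact_Icc (a := -π) (b := π))).exists_bound_of_continuousOn hc.continuousOn
  have hfc := hf.continuous
  have hpc := (hf.pd 0).continuous
  have hpi : (-π) ≤ π := by linarith [pi_pos]
  refine (intervalIntegral.hasDerivAt_integral_of_dominated_loc_of_deriv_le (μ := volume)
    (F := fun r z => f (hp r z)) (F' := fun r z => pd 0 f (hp r z)) (s := Icc (r - 1) (r + 1))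
    (bound := fun _ => C) (Icc_mem_nhds (by linarith) (by linarith)) ?_ ?_ ?_ ?_ ?_ ?_).2
  · exact Eventually.of_forall fun s => Continuous.aestronglyMeasurable (by fun_prop)
  · exact intervalIntegrable_hp hfc _ _ _
  · exact Continuous.aestronglyMeasurable (by fun_prop)
  · refine Eventually.of_forall fun z hz s hs => hC (s, z) ⟨hs, ?_⟩
    rw [uIoc_of_le hpi] at hz
    exact ⟨hz.1.le, hz.2⟩
  · simp
  · exact Eventually.of_forall fun z _ s _ => hasDerivAt_hp_left hf s z

/-- Invariance under the shift by one period in `x₃`. -/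
def ZPer (f : E3 → ℝ) : Prop :=
  ∀ x : E3, f (x + (2 * π) • EuclideanSpace.single (2 : Fin 3) (1 : ℝ)) = f x

theorem ZPer.hp {f : E3 → ℝ} (hf : ZPer f) (r : ℝ) :
    Function.Periodic (fun z => f (hp r z)) (2 * π) := by
  intro z
  have := hf (_root_.hp r z)
  simpa [_root_.hp, add_smul, add_assoc] using this

theorem ZPer.pd {f : E3 → ℝ} (hf : ZPer f) (i : Fin 3) : ZPer (pd i f) := by
  intro x
  have h : (fun y : E3 => f (y + (2 * π) • EuclideanSpace.single (2 : Fin 3) (1 : ℝ))) = f :=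
    funext hf
  unfold _root_.pd
  conv_rhs => rw [← h]
  rw [fderiv_comp_add_right]

theorem zint_pd_two {f : E3 → ℝ} (hf : ContDiff ℝ (⊤ : ℕ∞) f) (hp' : ZPer f) (r : ℝ) :
    zint (pd 2 f) r = 0 := by
  unfold zint
  rw [intervalIntegral.integral_eq_sub_of_hasDerivAt
    (fun z _ => hasDerivAt_hp_right hf r z) (intervalIntegrable_hp (hf.pd 2).continuous _ _ _)]
  have := hp'.hp r (-π)
  simp only at this
  rw [show -π + 2 * π = π by ring] at this
  rw [this, sub_self]

theorem zint_add {f g : E3 → ℝ} (hf : Continuous f) (hg : Continuous g) (r : ℝ) :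
    zint (fun x => f x + g x) r = zint f r + zint g r :=
  intervalIntegral.integral_add (intervalIntegrable_hp hf _ _ _) (intervalIntegrable_hp hg _ _ _)

theorem zint_const_mul (c : ℝ) (f : E3 → ℝ) (r : ℝ) :
    zint (fun x => c * f x) r = c * zint f r :=
  intervalIntegral.integral_const_mul _ _

theorem zint_congr {f g : E3 → ℝ} {r : ℝ} (h : ∀ z, f (hp r z) = g (hp r z)) :
    zint f r = zint g r := by
  unfold zint
  simp only [h]

theorem zint_mono {f g : E3 → ℝ} {r : ℝ} (hf : Continuous f) (hg : Continuous g)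
    (h : ∀ z ∈ Icc (-π) π, f (hp r z) ≤ g (hp r z)) : zint f r ≤ zint g r :=
  intervalIntegral.integral_mono_on (by linarith [pi_pos]) (intervalIntegrable_hp hf _ _ _)
    (intervalIntegrable_hp hg _ _ _) h

theorem zint_const (c r : ℝ) : zint (fun _ => c) r = 2 * π * c := by
  unfold zint
  rw [intervalIntegral.integral_const, smul_eq_mul]
  ring

theorem zint_nonneg {f : E3 → ℝ} {r : ℝ} (h : ∀ z, 0 ≤ f (hp r z)) : 0 ≤ zint f r :=
  intervalIntegral.integral_nonneg (by linarith [pi_pos]) fun z _ => h z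

/-- The Cauchy–Schwarz inequality for integrals over a period. -/
theorem zint_mul_sq_le {f g : E3 → ℝ} (hf : Continuous f) (hg : Continuous g) (r : ℝ) :
    zint (fun x => f x * g x) r ^ 2 ≤ zint (fun x => f x ^ 2) r * zint (fun x => g x ^ 2) r := by
  have key : ∀ t : ℝ, 0 ≤ zint (fun x => f x ^ 2) r * (t * t) +
      (2 * zint (fun x => f x * g x) r) * t + zint (fun x => g x ^ 2) r := by
    intro t
    have h0 : 0 ≤ zint (fun x => (t * t) * f x ^ 2 + ((2 * t) * (f x * g x) + g x ^ 2)) r :=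
      zint_nonneg fun z => by nlinarith [sq_nonneg (t * f (hp r z) + g (hp r z))]
    rw [zint_add (by fun_prop) (by fun_prop), zint_add (by fun_prop) (by fun_prop),
      zint_const_mul, zint_const_mul] at h0
    linarith
  have := discrim_le_zero key
  unfold discrim at this
  nlinarith

/-- A continuous nonnegative `z`-periodic function with vanishing integral vanishes. -/
theorem eq_zero_of_zint_eq_zero {f : E3 → ℝ} {r : ℝ} (hf : Continuous f) (hper : ZPer f)
    (h0 : ∀ z, 0 ≤ f (hp r z)) (h : zint f r = 0) (z : ℝ) : f (hp r z) = 0 := by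
  have hpi : -π < π := by linarith [pi_pos]
  have hz : ∀ z ∈ Icc (-π) π, f (hp r z) = 0 := by
    intro z hz
    by_contra hne
    have : 0 < zint f r :=
      intervalIntegral.integral_pos hpi (Continuous.continuousOn (by fun_prop))
        (fun z _ => h0 z) ⟨z, hz, lt_of_le_of_ne (h0 z) (Ne.symm hne)⟩
    exact this.ne' h
  obtain ⟨y, hy, hy'⟩ := (hper.hp r).exists_mem_Ico (by linarith : 0 < 2 * π) z (-π)
  change f (hp r z) = f (hp r y) at hy'
  rw [hy']
  exact hz y ⟨hy.1, by linarith [hy.2]⟩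

/-- A Riccati-type differential inequality on a set of radii of finite complement forces a
nondecreasing function to be nonpositive. -/
theorem nonpos_of_riccati {F F' ψ : ℝ → ℝ} {B C M : ℝ} (hC : 0 < C)
    (hF : ∀ r, 0 < r → HasDerivAt F (F' r) r) (hF' : ∀ r, 0 < r → 0 ≤ F' r)
    (hψ : Continuous ψ) (hψ0 : ∀ r, 0 ≤ ψ r) (hM : ∀ T, 1 ≤ T → ∫ r in (1 : ℝ)..T, ψ r ≤ M)
    (h : ∀ r, 1 ≤ r → ψ r ≤ 1 → ∃ X, F r ≤ X + B / r ∧ X ^ 2 ≤ C * r * F' r)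
    {r : ℝ} (hr : 0 < r) : F r ≤ 0 := by
  by_contra! hδ
  have hmono : MonotoneOn F (Ioi 0) := by
    refine monotoneOn_of_deriv_nonneg (convex_Ioi 0)
      (fun x hx => (hF x hx).continuousAt.continuousWithinAt) ?_ ?_
    · intro x hx
      rw [interior_Ioi] at hx
      exact (hF x hx).differentiableAt.differentiableWithinAt
    · intro x hx
      rw [interior_Ioi] at hx
      rw [(hF x hx).deriv]
      exact hF' x hx
  set R := max (max r 1) (2 * B / F r) with hR
  have hRr : r ≤ R := le_trans (le_max_left _ _) (le_max_left _ _)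
  have hR1 : 1 ≤ R := le_trans (le_max_right _ _) (le_max_left _ _)
  have hRB : 2 * B / F r ≤ R := le_max_right _ _
  have hge : ∀ s, R ≤ s → F r ≤ F s := fun s hs =>
    hmono hr (lt_of_lt_of_le hr (hRr.trans hs)) (hRr.trans hs)
  have hpt : ∀ s, R ≤ s → 0 ≤ F' s / F s ^ 2 + ψ s / (4 * C) - 1 / s / (4 * C) := by
    intro s hs
    have hs1 : 1 ≤ s := hR1.trans hs
    have hs0 : 0 < s := by linarith
    have hFs : 0 < F s := lt_of_lt_of_le hδ (hge s hs)
    have hinv : 1 / s ≤ 1 := by rw [div_le_one hs0]; exact hs1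
    rcases le_or_gt (ψ s) 1 with hψs | hψs
    · obtain ⟨X, hX, hX2⟩ := h s hs1 hψs
      have hB : B / s ≤ F s / 2 := by
        rw [div_le_iff₀ hs0]
        have := hRB.trans hs
        rw [div_le_iff₀ hδ] at this
        nlinarith [hge s hs]
      have hXF : F s / 2 ≤ X := by linarith
      have h1 : F s ^ 2 ≤ 4 * (C * s * F' s) := by nlinarith
      have h2 : 1 / s / (4 * C) ≤ F' s / F s ^ 2 := by
        rw [div_div, div_le_div_iff₀ (by positivity) (by positivity)]
        nlinarith
      have : 0 ≤ ψ s / (4 * C) := div_nonneg (hψ0 s) (by positivity)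
      linarith
    · have h1 : 1 / s / (4 * C) ≤ ψ s / (4 * C) := by gcongr; linarith
      have h2 : 0 ≤ F' s / F s ^ 2 := div_nonneg (hF' s hs0) (by positivity)
      linarith
  have hder : ∀ s, R ≤ s → HasDerivAt
      (fun s => -(F s)⁻¹ + (∫ t in (1 : ℝ)..s, ψ t) / (4 * C) - log s / (4 * C))
      (F' s / F s ^ 2 + ψ s / (4 * C) - 1 / s / (4 * C)) s := by
    intro s hs
    have hs0 : 0 < s := by linarith
    have hFs : 0 < F s := lt_of_lt_of_le hδ (hge s hs)
    have h1 := ((hF s hs0).inv hFs.ne').neg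
    have h2 := (intervalIntegral.integral_hasDerivAt_right (hψ.intervalIntegrable 1 s)
      (hψ.stronglyMeasurableAtFilter _ _) hψ.continuousAt).div_const (4 * C)
    have h3 := (Real.hasDerivAt_log hs0.ne').div_const (4 * C)
    have := (h1.add h2).sub h3
    refine this.congr_deriv ?_
    rw [one_div]
    ring
  have hmono2 : MonotoneOn
      (fun s => -(F s)⁻¹ + (∫ t in (1 : ℝ)..s, ψ t) / (4 * C) - log s / (4 * C)) (Ici R) := by
    refine monotoneOn_of_deriv_nonneg (convex_Ici R)
      (fun x hx => (hder x hx).continuousAt.continuousWithinAt) ?_ ?_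
    · intro x hx
      rw [interior_Ici] at hx
      exact (hder x (le_of_lt hx)).differentiableAt.differentiableWithinAt
    · intro x hx
      rw [interior_Ici] at hx
      rw [(hder x (le_of_lt hx)).deriv]
      exact hpt x (le_of_lt hx)
  obtain ⟨T, hTR, hT⟩ : ∃ T, R ≤ T ∧ M + 4 * C * (F R)⁻¹ + log R < log T :=
    ((eventually_ge_atTop R).and (Real.tendsto_log_atTop.eventually_gt_atTop _)).exists
  have hfin := hmono2 (mem_Ici.2 le_rfl) (mem_Ici.2 hTR) hTR
  simp only at hfin
  have hFT : 0 < (F T)⁻¹ := inv_pos.2 (lt_of_lt_of_le hδ (hge T hTR))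
  have hi0 : 0 ≤ ∫ t in (1 : ℝ)..R, ψ t :=
    intervalIntegral.integral_nonneg hR1 fun t _ => hψ0 t
  have hiM := hM T (hR1.trans hTR)
  have e1 : -(F R)⁻¹ - log R / (4 * C) ≤ M / (4 * C) - log T / (4 * C) := by
    have a1 : 0 ≤ (∫ t in (1 : ℝ)..R, ψ t) / (4 * C) := by positivity
    have a2 : (∫ t in (1 : ℝ)..T, ψ t) / (4 * C) ≤ M / (4 * C) := by gcongr
    linarith
  have e2 := mul_le_mul_of_nonneg_left e1 (by positivity : 0 ≤ 4 * C)
  have e3 : 4 * C * (-(F R)⁻¹ - log R / (4 * C)) = -(4 * C * (F R)⁻¹) - log R := by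
    field_simp
  have e4 : 4 * C * (M / (4 * C) - log T / (4 * C)) = M - log T := by
    field_simp
  rw [e3, e4] at e2
  linarith

/-! ### Rotational symmetry -/

/-- The point with cylindrical coordinates `(r, θ, z)`. -/
def cyl (r θ z : ℝ) : E3 :=
  (r * cos θ) • EuclideanSpace.single 0 1 + (r * sin θ) • EuclideanSpace.single 1 1 +
    z • EuclideanSpace.single 2 1

@[simp] theorem cyl_zero (r θ z : ℝ) : cyl r θ z 0 = r * cos θ := by simp [cyl]
@[simp] theorem cyl_one (r θ z : ℝ) : cyl r θ z 1 = r * sin θ := by simp [cyl]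
@[simp] theorem cyl_two (r θ z : ℝ) : cyl r θ z 2 = z := by simp [cyl]

theorem exists_eq_cyl (x : E3) : ∃ r θ z, 0 ≤ r ∧ x = cyl r θ z := by
  set w : ℂ := ⟨x 0, x 1⟩ with hw
  refine ⟨‖w‖, w.arg, x 2, norm_nonneg w, ?_⟩
  ext i
  fin_cases i
  · simp [hw]
  · simp [hw]
  · simp

theorem rr_cyl (r θ z : ℝ) : rr (cyl r θ z) = |r| := by
  have : (r * cos θ) ^ 2 + (r * sin θ) ^ 2 = r ^ 2 := by
    rw [mul_pow, mul_pow, ← mul_add, cos_sq_add_sin_sq, mul_one]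
  simp [rr, this, sqrt_sq_eq_abs]

theorem rr_hp (r z : ℝ) : rr (hp r z) = |r| := by
  simp [rr, sqrt_sq_eq_abs]

theorem fderiv_apply_eq_pd (f : E3 → ℝ) (x y : E3) :
    fderiv ℝ f x y = y 0 * pd 0 f x + y 1 * pd 1 f x + y 2 * pd 2 f x := by
  have hy : y = y 0 • EuclideanSpace.single 0 1 + y 1 • EuclideanSpace.single 1 1 +
      y 2 • EuclideanSpace.single 2 1 := by
    ext i
    fin_cases i <;> simp
  conv_lhs => rw [hy]
  simp [pd]

theorem hasDerivAt_cyl_angle {f : E3 → ℝ} (hf : ContDiff ℝ (⊤ : ℕ∞) f) (r θ z : ℝ) :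
    HasDerivAt (fun t => f (cyl r t z))
      (cyl r θ z 0 * pd 1 f (cyl r θ z) - cyl r θ z 1 * pd 0 f (cyl r θ z)) θ := by
  have h1 : HasDerivAt (fun t => cyl r t z)
      ((r * -sin θ) • EuclideanSpace.single 0 1 + (r * cos θ) • EuclideanSpace.single 1 1) θ :=
    ((((hasDerivAt_cos θ).const_mul r).smul_const _).add
      (((hasDerivAt_sin θ).const_mul r).smul_const _)).add_const _
  have := (hf.differentiable_top (cyl r θ z)).hasFDerivAt.comp_hasDerivAt θ h1
  refine this.congr_deriv ?_
  rw [fderiv_apply_eq_pd]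
  simp
  ring

theorem hasDerivAt_cyl_radius {f : E3 → ℝ} (hf : ContDiff ℝ (⊤ : ℕ∞) f) (r θ z : ℝ) :
    HasDerivAt (fun s => f (cyl s θ z))
      (cos θ * pd 0 f (cyl r θ z) + sin θ * pd 1 f (cyl r θ z)) r := by
  have h1 : HasDerivAt (fun s => cyl s θ z)
      ((1 * cos θ) • EuclideanSpace.single 0 1 + (1 * sin θ) • EuclideanSpace.single 1 1) r :=
    ((((hasDerivAt_id r).mul_const _).smul_const _).add
      (((hasDerivAt_id r).mul_const _).smul_const _)).add_const _
  have := (hf.differentiable_top (cyl r θ z)).hasFDerivAt.comp_hasDerivAt r h1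
  refine this.congr_deriv ?_
  rw [fderiv_apply_eq_pd]
  simp

theorem hasDerivAt_cyl_height {f : E3 → ℝ} (hf : ContDiff ℝ (⊤ : ℕ∞) f) (r θ z : ℝ) :
    HasDerivAt (fun s => f (cyl r θ s)) (pd 2 f (cyl r θ z)) z := by
  have h1 : HasDerivAt (fun s => cyl r θ s) ((1 : ℝ) • EuclideanSpace.single 2 1) z :=
    ((hasDerivAt_id z).smul_const _).const_add _
  have := (hf.differentiable_top (cyl r θ z)).hasFDerivAt.comp_hasDerivAt z h1
  refine this.congr_deriv ?_
  rw [fderiv_apply_eq_pd]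
  simp

/-- The components `a, b, c` of a smooth axisymmetric field without swirl, described through
their values in cylindrical coordinates. -/
structure AxisymComponents (a b c : E3 → ℝ) : Prop where
  smooth_a : ContDiff ℝ (⊤ : ℕ∞) a
  smooth_b : ContDiff ℝ (⊤ : ℕ∞) b
  smooth_c : ContDiff ℝ (⊤ : ℕ∞) c
  cyl_a : ∀ r θ z, a (cyl r θ z) = cos θ * a (hp r z)
  cyl_b : ∀ r θ z, b (cyl r θ z) = sin θ * a (hp r z)
  cyl_c : ∀ r θ z, c (cyl r θ z) = c (hp r z)

theorem hp_eq_cyl (r z : ℝ) : hp r z = cyl r 0 z := by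
  simp [hp, cyl]

namespace AxisymComponents

variable {a b c : E3 → ℝ} (h : AxisymComponents a b c)
include h

theorem b_hp (r z : ℝ) : b (hp r z) = 0 := by
  rw [hp_eq_cyl, h.cyl_b]
  simp

theorem a_axis (z : ℝ) : a (hp 0 z) = 0 := by
  have h1 := h.cyl_a 0 π z
  have h2 : cyl 0 π z = hp 0 z := by simp [hp, cyl]
  rw [h2, cos_pi] at h1
  linarith

theorem rot_a (x : E3) : x 0 * pd 1 a x - x 1 * pd 0 a x = -b x := by
  obtain ⟨r, θ, z, -, rfl⟩ := exists_eq_cyl x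
  have h1 := hasDerivAt_cyl_angle h.smooth_a r θ z
  have h2 : HasDerivAt (fun t => a (cyl r t z)) (-sin θ * a (hp r z)) θ := by
    simp only [h.cyl_a]
    exact (hasDerivAt_cos θ).mul_const _
  rw [h1.unique h2, h.cyl_b]
  ring

theorem rot_b (x : E3) : x 0 * pd 1 b x - x 1 * pd 0 b x = a x := by
  obtain ⟨r, θ, z, -, rfl⟩ := exists_eq_cyl x
  have h1 := hasDerivAt_cyl_angle h.smooth_b r θ z
  have h2 : HasDerivAt (fun t => b (cyl r t z)) (cos θ * a (hp r z)) θ := by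
    simp only [h.cyl_b]
    exact (hasDerivAt_sin θ).mul_const _
  rw [h1.unique h2, h.cyl_a]

theorem rot_c (x : E3) : x 0 * pd 1 c x - x 1 * pd 0 c x = 0 := by
  obtain ⟨r, θ, z, -, rfl⟩ := exists_eq_cyl x
  have h1 := hasDerivAt_cyl_angle h.smooth_c r θ z
  have h2 : HasDerivAt (fun t => c (cyl r t z)) 0 θ := by
    simp only [h.cyl_c]
    exact hasDerivAt_const _ _
  rw [h1.unique h2]

/-- The meridional part of the gradient is bounded by the full gradient. -/
theorem meridian_gradient_le (r θ z : ℝ) :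
    pd 0 a (hp r z) ^ 2 + pd 2 a (hp r z) ^ 2 + pd 0 c (hp r z) ^ 2 + pd 2 c (hp r z) ^ 2 ≤
      (pd 0 a (cyl r θ z) ^ 2 + pd 0 b (cyl r θ z) ^ 2 + pd 0 c (cyl r θ z) ^ 2) +
      (pd 1 a (cyl r θ z) ^ 2 + pd 1 b (cyl r θ z) ^ 2 + pd 1 c (cyl r θ z) ^ 2) +
      (pd 2 a (cyl r θ z) ^ 2 + pd 2 b (cyl r θ z) ^ 2 + pd 2 c (cyl r θ z) ^ 2) := by
  have hcs := cos_sq_add_sin_sq θ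
  have cs : ∀ s t : ℝ, (cos θ * s + sin θ * t) ^ 2 ≤ s ^ 2 + t ^ 2 := by
    intro s t
    have : s ^ 2 + t ^ 2 - (cos θ * s + sin θ * t) ^ 2 = (sin θ * s - cos θ * t) ^ 2 := by
      linear_combination (-(s ^ 2 + t ^ 2)) * hcs
    nlinarith [sq_nonneg (sin θ * s - cos θ * t)]
  have a0 : cos θ * pd 0 a (cyl r θ z) + sin θ * pd 1 a (cyl r θ z) = cos θ * pd 0 a (hp r z) := by
    refine (hasDerivAt_cyl_radius h.smooth_a r θ z).unique ?_
    simp only [h.cyl_a]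
    exact (hasDerivAt_hp_left h.smooth_a r z).const_mul _
  have b0 : cos θ * pd 0 b (cyl r θ z) + sin θ * pd 1 b (cyl r θ z) = sin θ * pd 0 a (hp r z) := by
    refine (hasDerivAt_cyl_radius h.smooth_b r θ z).unique ?_
    simp only [h.cyl_b]
    exact (hasDerivAt_hp_left h.smooth_a r z).const_mul _
  have c0 : cos θ * pd 0 c (cyl r θ z) + sin θ * pd 1 c (cyl r θ z) = pd 0 c (hp r z) := by
    refine (hasDerivAt_cyl_radius h.smooth_c r θ z).unique ?_
    simp only [h.cyl_c]
    exact hasDerivAt_hp_left h.smooth_c r z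
  have a2 : pd 2 a (cyl r θ z) = cos θ * pd 2 a (hp r z) := by
    refine (hasDerivAt_cyl_height h.smooth_a r θ z).unique ?_
    simp only [h.cyl_a]
    exact (hasDerivAt_hp_right h.smooth_a r z).const_mul _
  have b2 : pd 2 b (cyl r θ z) = sin θ * pd 2 a (hp r z) := by
    refine (hasDerivAt_cyl_height h.smooth_b r θ z).unique ?_
    simp only [h.cyl_b]
    exact (hasDerivAt_hp_right h.smooth_a r z).const_mul _
  have c2 : pd 2 c (cyl r θ z) = pd 2 c (hp r z) := by
    refine (hasDerivAt_cyl_height h.smooth_c r θ z).unique ?_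
    simp only [h.cyl_c]
    exact hasDerivAt_hp_right h.smooth_c r z
  have e1 := cs (pd 0 a (cyl r θ z)) (pd 1 a (cyl r θ z))
  have e2 := cs (pd 0 b (cyl r θ z)) (pd 1 b (cyl r θ z))
  have e3 := cs (pd 0 c (cyl r θ z)) (pd 1 c (cyl r θ z))
  rw [a0] at e1
  rw [b0] at e2
  rw [c0] at e3
  have e4 : (cos θ * pd 0 a (hp r z)) ^ 2 + (sin θ * pd 0 a (hp r z)) ^ 2 = pd 0 a (hp r z) ^ 2 := by
    linear_combination (pd 0 a (hp r z)) ^ 2 * hcs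
  have e5 : pd 2 a (cyl r θ z) ^ 2 + pd 2 b (cyl r θ z) ^ 2 = pd 2 a (hp r z) ^ 2 := by
    rw [a2, b2]
    linear_combination (pd 2 a (hp r z)) ^ 2 * hcs
  rw [c2]
  linarith

/-- Rotational invariance of `c`, differentiated in `x₂`; on the meridian half plane it says
`r ∂₂ ∂₂ c = ∂₁ c`. -/
theorem pd_one_one_c (x : E3) :
    x 0 * pd 1 (pd 1 c) x - pd 0 c x - x 1 * pd 1 (pd 0 c) x = 0 := by
  have hc := h.smooth_c
  have h0 : (fun x : E3 => x 0 * pd 1 c x - x 1 * pd 0 c x) = fun _ => 0 := funext h.rot_c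
  have h1 := congrArg (fun f => pd 1 f x) h0
  simp (disch := fun_prop) only [pd_sub, pd_mul, pd_coord, pd_const] at h1
  simp at h1
  linarith

theorem pd_zero_c_axis (z : ℝ) : pd 0 c (hp 0 z) = 0 := by
  have := h.pd_one_one_c (hp 0 z)
  simp at this
  linarith

theorem pd_two_a_axis (z : ℝ) : pd 2 a (hp 0 z) = 0 :=
  pd_two_of_eq_zero h.smooth_a h.a_axis z

theorem b_pd_zero (r z : ℝ) : pd 0 b (hp r z) = 0 :=
  (hasDerivAt_hp_left h.smooth_b r z).unique
    ((funext fun s => h.b_hp s z : (fun s => b (hp s z)) = fun _ => 0) ▸ hasDerivAt_const r (0 : ℝ))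

theorem b_pd_two (r z : ℝ) : pd 2 b (hp r z) = 0 :=
  pd_two_of_eq_zero h.smooth_b (h.b_hp r) z

theorem b_pd_one (r z : ℝ) : r * pd 1 b (hp r z) = a (hp r z) := by
  simpa using h.rot_b (hp r z)

/-- The second derivative of the vorticity across the meridian plane. -/
theorem vorticity_pd_one_one (r z : ℝ) :
    r ^ 2 * pd 1 (pd 1 fun x => pd 2 a x - pd 0 c x) (hp r z) =
      r * pd 0 (fun x => pd 2 a x - pd 0 c x) (hp r z) -
        (pd 2 a (hp r z) - pd 0 c (hp r z)) := by
  have ha := h.smooth_a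
  have hb := h.smooth_b
  have hc := h.smooth_c
  have A0 : (fun x : E3 => x 0 * pd 1 a x - x 1 * pd 0 a x) = fun x => -b x := funext h.rot_a
  have B0 : (fun x : E3 => x 0 * pd 1 b x - x 1 * pd 0 b x) = a := funext h.rot_b
  have C0 : (fun x : E3 => x 0 * pd 1 c x - x 1 * pd 0 c x) = fun _ => 0 := funext h.rot_c
  have rotω : (fun x : E3 => x 0 * pd 1 (fun x => pd 2 a x - pd 0 c x) x -
      x 1 * pd 0 (fun x => pd 2 a x - pd 0 c x) x) = fun x => pd 1 c x - pd 2 b x := by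
    funext x
    have h1 := congrArg (fun f => pd 2 f x) A0
    have h2 := congrArg (fun f => pd 0 f x) C0
    simp (disch := fun_prop) only [pd_sub, pd_mul, pd_coord, pd_const, pd_neg] at h1 h2 ⊢
    rw [pd_comm ha 2 1, pd_comm ha 2 0] at h1
    rw [pd_comm hc 0 1] at h2
    simp at h1 h2
    linarith
  have rotη : ∀ x : E3, x 0 * pd 1 (fun x => pd 1 c x - pd 2 b x) x -
      x 1 * pd 0 (fun x => pd 1 c x - pd 2 b x) x = -(pd 2 a x - pd 0 c x) := by
    intro x
    have h1 := congrArg (fun f => pd 2 f x) B0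
    have h2 := h.pd_one_one_c x
    simp (disch := fun_prop) only [pd_sub, pd_mul, pd_coord] at h1 ⊢
    rw [pd_comm hb 2 1, pd_comm hb 2 0] at h1
    rw [pd_comm hc 0 1]
    simp at h1 h2
    linarith
  have h3 := congrArg (fun f => pd 1 f (hp r z)) rotω
  have h4 := rotη (hp r z)
  set ω : E3 → ℝ := fun x => pd 2 a x - pd 0 c x with hω
  have hωs : ContDiff ℝ (⊤ : ℕ∞) ω := by fun_prop
  simp (disch := fun_prop) only [pd_sub, pd_mul, pd_coord, hp_zero, hp_one] at h3 h4
  simp at h3 h4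
  have e : pd 2 a (hp r z) - pd 0 c (hp r z) = ω (hp r z) := rfl
  linear_combination r * h3 + h4

end AxisymComponents

/-! ### The equations in the meridian plane -/

/-- Radial velocity `a`, vertical velocity `c` and vorticity `ω` of an axisymmetric flow without
swirl, with the continuity and vorticity equations in the meridian plane. -/
structure MeridianFlow (a c ω : E3 → ℝ) : Prop where
  smooth_a : ContDiff ℝ (⊤ : ℕ∞) a
  smooth_c : ContDiff ℝ (⊤ : ℕ∞) c
  smooth_ω : ContDiff ℝ (⊤ : ℕ∞) ω
  per_a : ZPer a
  per_c : ZPer c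
  per_ω : ZPer ω
  ω_eq : ∀ x, ω x = pd 2 a x - pd 0 c x
  ω_axis : ∀ z, ω (hp 0 z) = 0
  continuity : ∀ r z, r * pd 0 a (hp r z) + a (hp r z) + r * pd 2 c (hp r z) = 0
  vorticity : ∀ r z, r ^ 2 * (a (hp r z) * pd 0 ω (hp r z) + c (hp r z) * pd 2 ω (hp r z)) -
    r * a (hp r z) * ω (hp r z) =
      r ^ 2 * (pd 0 (pd 0 ω) (hp r z) + pd 2 (pd 2 ω) (hp r z)) + r * pd 0 ω (hp r z) - ω (hp r z)

theorem AxisymComponents.meridianFlow {a b c p : E3 → ℝ} (h : AxisymComponents a b c)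
    (hp_smooth : ContDiff ℝ (⊤ : ℕ∞) p) (per_a : ZPer a) (per_c : ZPer c)
    (m0 : ∀ x, a x * pd 0 a x + b x * pd 1 a x + c x * pd 2 a x + pd 0 p x =
      pd 0 (pd 0 a) x + pd 1 (pd 1 a) x + pd 2 (pd 2 a) x)
    (m2 : ∀ x, a x * pd 0 c x + b x * pd 1 c x + c x * pd 2 c x + pd 2 p x =
      pd 0 (pd 0 c) x + pd 1 (pd 1 c) x + pd 2 (pd 2 c) x)
    (dv : ∀ x, pd 0 a x + pd 1 b x + pd 2 c x = 0) :
    MeridianFlow a c fun x => pd 2 a x - pd 0 c x := by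
  have ha := h.smooth_a
  have hb := h.smooth_b
  have hc := h.smooth_c
  have hdiv : ∀ r z, r * pd 0 a (hp r z) + a (hp r z) + r * pd 2 c (hp r z) = 0 := by
    intro r z
    linear_combination r * dv (hp r z) - h.b_pd_one r z
  refine ⟨ha, hc, by fun_prop, per_a, per_c, ?_, fun _ => rfl, ?_, hdiv, ?_⟩
  · intro x
    change pd 2 a _ - pd 0 c _ = pd 2 a x - pd 0 c x
    rw [per_a.pd 2 x, per_c.pd 0 x]
  · intro z
    rw [h.pd_two_a_axis, h.pd_zero_c_axis, sub_zero]
  · intro r z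
    have h1 := congrArg (fun f => pd 2 f (hp r z)) (funext m0)
    have h2 := congrArg (fun f => pd 0 f (hp r z)) (funext m2)
    have hw := h.vorticity_pd_one_one r z
    have hd := hdiv r z
    simp (disch := fun_prop) only [pd_sub, pd_mul, pd_add] at h1 h2 hw ⊢
    rw [pd_comm hp_smooth 2 0] at h1
    have ca : ∀ i, pd 2 (pd i a) = pd i (pd 2 a) := fun i => funext fun x => pd_comm ha 2 i x
    have cc : ∀ i, pd 0 (pd i c) = pd i (pd 0 c) := fun i => funext fun x => pd_comm hc 0 i x
    have la : ∀ i, pd 2 (pd i (pd i a)) (hp r z) = pd i (pd i (pd 2 a)) (hp r z) := fun i => by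
      rw [pd_comm (ha.pd i) 2 i, ca i]
    have lc : ∀ i, pd 0 (pd i (pd i c)) (hp r z) = pd i (pd i (pd 0 c)) (hp r z) := fun i => by
      rw [pd_comm (hc.pd i) 0 i, cc i]
    have lw : ∀ i, pd i (pd i fun x => pd 2 a x - pd 0 c x) (hp r z) =
        pd i (pd i (pd 2 a)) (hp r z) - pd i (pd i (pd 0 c)) (hp r z) := fun i => by
      have : (pd i fun x => pd 2 a x - pd 0 c x) =
          fun x => pd i (pd 2 a) x - pd i (pd 0 c) x := by
        funext x
        exact pd_sub (ha.pd 2) (hc.pd 0) i x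
      rw [this, pd_sub (by fun_prop) (by fun_prop)]
    rw [la 0, la 1, h.b_hp, h.b_pd_two, ca 0] at h1
    rw [lc 1, lc 2, h.b_hp, h.b_pd_zero, cc 2] at h2
    rw [lw] at hw
    rw [lw 0, lw 2]
    linear_combination r ^ 2 * (h1 - h2) - r * (pd 2 a (hp r z) - pd 0 c (hp r z)) * hd + hw

/-! ### Vanishing of the vorticity and of the radial velocity -/

/-- The squared norm of the gradient of `(a, c)` in the meridian plane. -/
def merGradSq (a c : E3 → ℝ) (x : E3) : ℝ :=
  pd 0 a x ^ 2 + pd 2 a x ^ 2 + pd 0 c x ^ 2 + pd 2 c x ^ 2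

namespace MeridianFlow

variable {a c ω : E3 → ℝ} (h : MeridianFlow a c ω)
include h

theorem continuous_merGradSq : Continuous (merGradSq a c) := by
  have h1 := (h.smooth_a.pd 0).continuous
  have h2 := (h.smooth_a.pd 2).continuous
  have h3 := (h.smooth_c.pd 0).continuous
  have h4 := (h.smooth_c.pd 2).continuous
  unfold merGradSq
  fun_prop

theorem zint_a {r : ℝ} (hr : 0 < r) : zint a r = 0 := by
  have ha := h.smooth_a
  have hac := ha.continuous
  have ha0 := (ha.pd 0).continuous
  have hd : ∀ s, HasDerivAt (fun s => s * zint a s) 0 s := by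
    intro s
    refine ((hasDerivAt_id s).mul (hasDerivAt_zint ha s)).congr_deriv ?_
    have h1 : zint (fun x => a x + s * pd 0 a x) s = zint (fun x => -s * pd 2 c x) s :=
      zint_congr fun z => by linear_combination h.continuity s z
    rw [zint_add (by fun_prop) (by fun_prop), zint_const_mul, zint_const_mul,
      zint_pd_two h.smooth_c h.per_c] at h1
    simp only [id]
    linarith
  have hc := is_const_of_deriv_eq_zero (fun s => (hd s).differentiableAt)
    (fun s => (hd s).deriv) r 0
  simpa [hr.ne'] using hc

theorem zint_merGradSq_le {r : ℝ} (hψ : zint (fun x => max (merGradSq a c x - 1) 0) r ≤ 1) :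
    zint (merGradSq a c) r ≤ 8 := by
  have hg := h.continuous_merGradSq
  have h1 : zint (merGradSq a c) r ≤ zint (fun x => 1 + max (merGradSq a c x - 1) 0) r :=
    zint_mono (by fun_prop) (by fun_prop) fun z _ => by
      linarith [le_max_left (merGradSq a c (hp r z) - 1) 0]
  rw [zint_add (by fun_prop) (by fun_prop), zint_const] at h1
  linarith [pi_lt_d2]

theorem zint_ω_sq_le {r : ℝ} (hG : zint (merGradSq a c) r ≤ 8) :
    zint (fun x => ω x ^ 2) r ≤ 16 := by
  have hg := h.continuous_merGradSq
  have hω := h.smooth_ω.continuous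
  have h1 : zint (fun x => ω x ^ 2) r ≤ zint (fun x => 2 * merGradSq a c x) r :=
    zint_mono (by fun_prop) (by fun_prop) fun z _ => by
      rw [h.ω_eq]
      unfold merGradSq
      nlinarith [sq_nonneg (pd 2 a (hp r z) + pd 0 c (hp r z)), sq_nonneg (pd 0 a (hp r z)),
        sq_nonneg (pd 2 c (hp r z))]
  rw [zint_const_mul] at h1
  linarith

theorem exists_a_eq_zero {r : ℝ} (hr : 0 < r) : ∃ z ∈ Icc (-π) π, a (hp r z) = 0 := by
  have hac := h.smooth_a.continuous
  have hpi : -π < π := by linarith [pi_pos]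
  have hcont : ContinuousOn (fun z => a (hp r z)) (Icc (-π) π) :=
    Continuous.continuousOn (by fun_prop)
  have hint := h.zint_a hr
  by_contra! hne
  have hpre : IsPreconnected ((fun z => a (hp r z)) '' Icc (-π) π) :=
    isPreconnected_Icc.image _ hcont
  have h0 : (0 : ℝ) ∉ (fun z => a (hp r z)) '' Icc (-π) π := by
    rintro ⟨z, hz, h0⟩
    exact hne z hz h0
  have hm : (-π) ∈ Icc (-π) π := ⟨le_rfl, hpi.le⟩
  rcases lt_or_gt_of_ne (hne _ hm) with hneg | hpos
  · have hall : ∀ z ∈ Icc (-π) π, a (hp r z) < 0 := by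
      intro z hz
      by_contra! hz0
      exact h0 (hpre.Icc_subset (mem_image_of_mem _ hm) (mem_image_of_mem _ hz) ⟨hneg.le, hz0⟩)
    have : 0 < ∫ z in (-π)..π, -a (hp r z) :=
      intervalIntegral.integral_pos hpi hcont.neg
        (fun z hz => by linarith [hall z (Ioc_subset_Icc_self hz)])
        ⟨_, hm, by linarith⟩
    rw [intervalIntegral.integral_neg] at this
    unfold zint at hint
    linarith
  · have hall : ∀ z ∈ Icc (-π) π, 0 < a (hp r z) := by
      intro z hz
      by_contra! hz0
      exact h0 (hpre.Icc_subset (mem_image_of_mem _ hz) (mem_image_of_mem _ hm) ⟨hz0, hpos.le⟩)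
    have : 0 < ∫ z in (-π)..π, a (hp r z) :=
      intervalIntegral.integral_pos hpi hcont
        (fun z hz => (hall z (Ioc_subset_Icc_self hz)).le) ⟨_, hm, hpos⟩
    exact this.ne' hint

theorem abs_a_le {r : ℝ} (hr : 0 < r) (hG : zint (merGradSq a c) r ≤ 8) {z : ℝ}
    (hz : z ∈ Icc (-π) π) : |a (hp r z)| ≤ 8 := by
  obtain ⟨y, hy, hy0⟩ := h.exists_a_eq_zero hr
  have hg := h.continuous_merGradSq
  have ha2 := (h.smooth_a.pd 2).continuous
  have h1 : ∫ t in y..z, pd 2 a (hp r t) = a (hp r z) := by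
    rw [intervalIntegral.integral_eq_sub_of_hasDerivAt
      (fun t _ => hasDerivAt_hp_right h.smooth_a r t) (intervalIntegrable_hp ha2 _ _ _), hy0,
      sub_zero]
  have h2 : |a (hp r z)| ≤ zint (fun x => |pd 2 a x|) r := by
    rw [← h1]
    refine (intervalIntegral.norm_integral_le_integral_norm_uIoc (μ := volume)
      (f := fun t => pd 2 a (hp r t))).trans ?_
    unfold zint
    rw [intervalIntegral.integral_of_le (by linarith [pi_pos])]
    refine setIntegral_mono_set ?_ (Eventually.of_forall fun t => abs_nonneg _) ?_
    · exact (intervalIntegrable_iff_integrableOn_Ioc_of_le (by linarith [pi_pos])).1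
        (intervalIntegrable_hp ha2.abs r _ _)
    · exact (Ioc_subset_Ioc (le_min hy.1 hz.1) (max_le hy.2 hz.2)).eventuallyLE
  have h3 : zint (fun x => |pd 2 a x|) r ≤ zint (fun x => 1 / 2 + 1 / 2 * merGradSq a c x) r :=
    zint_mono (by fun_prop) (by fun_prop) fun z _ => by
      unfold merGradSq
      nlinarith [sq_nonneg (|pd 2 a (hp r z)| - 1), sq_abs (pd 2 a (hp r z)),
        sq_nonneg (pd 0 a (hp r z)), sq_nonneg (pd 0 c (hp r z)), sq_nonneg (pd 2 c (hp r z))]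
  rw [zint_add (by fun_prop) (by fun_prop), zint_const, zint_const_mul] at h3
  linarith [pi_lt_d2]

theorem ω_eq_zero {M : ℝ}
    (hM : ∀ T, 1 ≤ T → ∫ r in (1 : ℝ)..T, zint (fun x => max (merGradSq a c x - 1) 0) r ≤ M)
    {r : ℝ} (hr : 0 < r) (z : ℝ) : ω (hp r z) = 0 := by
  have ha := h.smooth_a
  have hc := h.smooth_c
  have hω := h.smooth_ω
  have hac := ha.continuous
  have hωc := hω.continuous
  have hω0 := (hω.pd 0).continuous
  have hω2 := (hω.pd 2).continuous
  have hg := h.continuous_merGradSq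
  set n : E3 → ℝ := fun x => ω x * pd 0 ω x - 1 / 2 * (a x * (ω x * ω x)) with hn
  have hns : ContDiff ℝ (⊤ : ℕ∞) n := by fun_prop
  have hnc := hns.continuous
  have hn0c := (hns.pd 0).continuous
  have pd_n : ∀ x, pd 0 n x = pd 0 ω x * pd 0 ω x + ω x * pd 0 (pd 0 ω) x -
      1 / 2 * (pd 0 a x * (ω x * ω x) + a x * (pd 0 ω x * ω x + ω x * pd 0 ω x)) := by
    intro x
    rw [hn, pd_sub (by fun_prop) (by fun_prop), pd_mul (by fun_prop) (by fun_prop),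
      pd_mul (by fun_prop) (by fun_prop), pd_mul (by fun_prop) (by fun_prop),
      pd_mul (by fun_prop) (by fun_prop), pd_const]
    ring
  set m : E3 → ℝ := fun x => 1 / 2 * (c x * (ω x * ω x)) - ω x * pd 2 ω x with hm
  have hms : ContDiff ℝ (⊤ : ℕ∞) m := by fun_prop
  have hm2c := (hms.pd 2).continuous
  have pd_m : ∀ x, pd 2 m x =
      1 / 2 * (pd 2 c x * (ω x * ω x) + c x * (pd 2 ω x * ω x + ω x * pd 2 ω x)) -
        (pd 2 ω x * pd 2 ω x + ω x * pd 2 (pd 2 ω) x) := by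
    intro x
    rw [hm, pd_sub (by fun_prop) (by fun_prop), pd_mul (by fun_prop) (by fun_prop),
      pd_mul (by fun_prop) (by fun_prop), pd_mul (by fun_prop) (by fun_prop),
      pd_mul (by fun_prop) (by fun_prop), pd_const]
    ring
  have hmper : ZPer m := by
    intro x
    simp only [hm]
    rw [h.per_c x, h.per_ω x, (h.per_ω.pd 2) x]
  set D : ℝ → E3 → ℝ := fun r x => (pd 0 ω x - r⁻¹ * ω x) ^ 2 + pd 2 ω x ^ 2 with hD
  have hDc : ∀ r, Continuous (D r) := fun r => by fun_prop
  have hDnn : ∀ r z, 0 ≤ D r (hp r z) := fun r z => by positivity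
  have hidentity : ∀ r, 0 < r → zint (pd 0 n) r - r⁻¹ * zint n r = zint (D r) r := by
    intro r hr
    have h1 : zint (fun x => pd 0 n x + -r⁻¹ * n x) r = zint (fun x => D r x + pd 2 m x) r := by
      refine zint_congr fun z => ?_
      have hv := h.vorticity r z
      have hd := h.continuity r z
      rw [pd_n, pd_m]
      simp only [hn, hD]
      field_simp
      linear_combination (-2 * ω (hp r z)) * hv - r * ω (hp r z) ^ 2 * hd
    rw [zint_add (by fun_prop) (by fun_prop), zint_add (hDc r) (by fun_prop), zint_const_mul,
      zint_pd_two hms hmper] at h1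
    linarith
  have hF : ∀ r, 0 < r → HasDerivAt (fun s => s⁻¹ * zint n s) (r⁻¹ * zint (D r) r) r := by
    intro r hr
    refine ((hasDerivAt_inv hr.ne').mul (hasDerivAt_zint hns r)).congr_deriv ?_
    rw [← hidentity r hr]
    field_simp
    ring
  have hF' : ∀ r, 0 < r → 0 ≤ r⁻¹ * zint (D r) r := fun r hr =>
    mul_nonneg (inv_nonneg.2 hr.le) (zint_nonneg (hDnn r))
  have hψc : Continuous (zint fun x => max (merGradSq a c x - 1) 0) :=
    continuous_zint (by fun_prop)
  have hle : ∀ r, 0 < r → r⁻¹ * zint n r ≤ 0 := by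
    intro r hr
    refine nonpos_of_riccati (B := 80) (C := 16) (by norm_num) hF hF' hψc
      (fun s => zint_nonneg fun z => le_max_right _ _) hM ?_ hr
    intro s hs hψs
    have hs0 : 0 < s := by linarith
    have hi : 0 < s⁻¹ := inv_pos.2 hs0
    have hi1 : s⁻¹ ≤ 1 := inv_le_one_of_one_le₀ hs
    have hG := h.zint_merGradSq_le hψs
    have hW := h.zint_ω_sq_le hG
    refine ⟨s⁻¹ * zint (fun x => ω x * (pd 0 ω x - s⁻¹ * ω x)) s, ?_, ?_⟩
    · have h1 : zint n s ≤ zint (fun x => ω x * (pd 0 ω x - s⁻¹ * ω x) + 5 * ω x ^ 2) s := by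
        refine zint_mono hnc (by fun_prop) fun z hz => ?_
        have habs := h.abs_a_le hs0 hG hz
        have := neg_abs_le (a (hp s z))
        simp only [hn]
        have h2 : 0 ≤ (5 + 1 / 2 * a (hp s z) - s⁻¹) * ω (hp s z) ^ 2 :=
          mul_nonneg (by linarith) (sq_nonneg _)
        linarith
      rw [zint_add (by fun_prop) (by fun_prop), zint_const_mul] at h1
      have h3 : zint n s ≤ zint (fun x => ω x * (pd 0 ω x - s⁻¹ * ω x)) s + 80 := by linarith
      have h4 := mul_le_mul_of_nonneg_left h3 hi.le
      rw [div_eq_mul_inv]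
      linarith
    · have h1 := zint_mul_sq_le (f := ω) (g := fun x => pd 0 ω x - s⁻¹ * ω x)
        (by fun_prop) (by fun_prop) s
      have h2 : zint (fun x => (pd 0 ω x - s⁻¹ * ω x) ^ 2) s ≤ zint (D s) s :=
        zint_mono (by fun_prop) (hDc s) fun z _ => by
          simp only [hD]
          nlinarith [sq_nonneg (pd 2 ω (hp s z))]
      have h0 : 0 ≤ zint (fun x => (pd 0 ω x - s⁻¹ * ω x) ^ 2) s :=
        zint_nonneg fun z => sq_nonneg _
      have h3 : zint (fun x => ω x * (pd 0 ω x - s⁻¹ * ω x)) s ^ 2 ≤ 16 * zint (D s) s :=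
        h1.trans (mul_le_mul hW h2 h0 (by norm_num))
      have e : 16 * s * (s⁻¹ * zint (D s) s) = 16 * zint (D s) s := by field_simp
      rw [e, mul_pow]
      have h5 : s⁻¹ ^ 2 ≤ 1 := pow_le_one₀ hi.le hi1
      nlinarith [sq_nonneg (zint (fun x => ω x * (pd 0 ω x - s⁻¹ * ω x)) s)]
  have hmono : MonotoneOn (fun s => s⁻¹ * zint n s) (Ioi 0) := by
    refine monotoneOn_of_deriv_nonneg (convex_Ioi 0)
      (fun x hx => (hF x hx).continuousAt.continuousWithinAt) ?_ ?_
    · intro x hx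
      rw [interior_Ioi] at hx
      exact (hF x hx).differentiableAt.differentiableWithinAt
    · intro x hx
      rw [interior_Ioi] at hx
      rw [(hF x hx).deriv]
      exact hF' x hx
  have hzero : zint n 0 = 0 := by
    rw [zint_congr (g := fun _ => (0 : ℝ)) (fun z => by simp [hn, h.ω_axis z]), zint_const,
      mul_zero]
  have hder0 : 0 ≤ zint (pd 0 n) 0 := by
    refine zint_nonneg fun z => ?_
    rw [pd_n, h.ω_axis]
    nlinarith [mul_self_nonneg (pd 0 ω (hp 0 z))]
  have hge : ∀ r, 0 < r → 0 ≤ r⁻¹ * zint n r := by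
    intro r hr
    have ht := (hasDerivAt_zint hns 0).tendsto_slope_zero_right
    refine hder0.trans (le_of_tendsto ht ?_)
    filter_upwards [Ioo_mem_nhdsGT hr] with s hs
    rw [zero_add, hzero, sub_zero, smul_eq_mul]
    exact hmono hs.1 hr hs.2.le
  have hF0 : ∀ r, 0 < r → r⁻¹ * zint n r = 0 := fun r hr => le_antisymm (hle r hr) (hge r hr)
  have hn0 : zint n r = 0 := by
    have := hF0 r hr
    simpa [hr.ne'] using this
  have hD0 : zint (D r) r = 0 := by
    have h1 : (fun s => s⁻¹ * zint n s) =ᶠ[𝓝 r] fun _ => 0 := by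
      filter_upwards [lt_mem_nhds hr] with s hs using hF0 s hs
    have := (hF r hr).unique ((hasDerivAt_const r (0 : ℝ)).congr_of_eventuallyEq h1)
    simpa [hr.ne'] using this
  have hDper : ZPer (D r) := by
    intro x
    simp only [hD]
    rw [h.per_ω x, (h.per_ω.pd 2) x, (h.per_ω.pd 0) x]
  have hpt : ∀ z, D r (hp r z) = 0 := eq_zero_of_zint_eq_zero (hDc r) hDper (hDnn r) hD0
  have hω2z : ∀ z, pd 2 ω (hp r z) = 0 := fun z => by
    have := hpt z
    simp only [hD] at this
    nlinarith [sq_nonneg (pd 0 ω (hp r z) - r⁻¹ * ω (hp r z)), sq_nonneg (pd 2 ω (hp r z))]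
  have hω0z : ∀ z, pd 0 ω (hp r z) = r⁻¹ * ω (hp r z) := fun z => by
    have := hpt z
    simp only [hD, hω2z z] at this
    nlinarith
  have hconst : ∀ y, ω (hp r y) = ω (hp r z) := fun y =>
    is_const_of_deriv_eq_zero (fun s => (hasDerivAt_hp_right hω r s).differentiableAt)
      (fun s => by rw [(hasDerivAt_hp_right hω r s).deriv, hω2z]) y z
  set k := ω (hp r z)
  have h1 : zint n r = zint (fun x => r⁻¹ * k ^ 2 + (-(1 / 2) * k ^ 2) * a x) r := by
    refine zint_congr fun y => ?_
    simp only [hn]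
    rw [hω0z, hconst]
    ring
  rw [hn0, zint_add (by fun_prop) (by fun_prop), zint_const, zint_const_mul, h.zint_a hr,
    mul_zero, add_zero] at h1
  have : k ^ 2 = 0 := by
    simpa [hr.ne', pi_ne_zero] using h1.symm
  exact pow_eq_zero_iff two_ne_zero |>.1 this

theorem a_eq_zero {M : ℝ}
    (hM : ∀ T, 1 ≤ T → ∫ r in (1 : ℝ)..T, zint (fun x => max (merGradSq a c x - 1) 0) r ≤ M)
    {r : ℝ} (hr : 0 < r) (z : ℝ) : a (hp r z) = 0 := by
  have ha := h.smooth_a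
  have hc := h.smooth_c
  have hac := ha.continuous
  have ha0 := (ha.pd 0).continuous
  have ha2 := (ha.pd 2).continuous
  have hg := h.continuous_merGradSq
  have hω : ∀ r z, 0 < r → ω (hp r z) = 0 := fun r z hr => h.ω_eq_zero hM hr z
  set n : E3 → ℝ := fun x => x 0 * (a x * pd 0 a x) with hn
  have hns : ContDiff ℝ (⊤ : ℕ∞) n := by fun_prop
  have hn0c := (hns.pd 0).continuous
  set m : E3 → ℝ := fun x => x 0 * (a x * pd 2 a x) with hm
  have hms : ContDiff ℝ (⊤ : ℕ∞) m := by fun_prop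
  have hm2c := (hms.pd 2).continuous
  have hmper : ZPer m := by
    intro x
    simp only [hm]
    rw [h.per_a x, (h.per_a.pd 2) x]
    simp
  have laplace : ∀ r z, 0 < r → r ^ 2 * (pd 0 (pd 0 a) (hp r z) + pd 2 (pd 2 a) (hp r z)) +
      r * pd 0 a (hp r z) - a (hp r z) = 0 := by
    intro r z hr
    have h1 := pd_zero_of_eq_zero (f := fun x => x 0 * pd 0 a x + a x + x 0 * pd 2 c x)
      (by fun_prop) (fun r z _ => by simpa using h.continuity r z) (z := z) hr
    have h2 : pd 2 (pd 2 a) (hp r z) - pd 2 (pd 0 c) (hp r z) = 0 := by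
      rw [← pd_sub (by fun_prop) (by fun_prop)]
      refine pd_two_of_eq_zero (by fun_prop) (fun z => ?_) z
      rw [← h.ω_eq]
      exact hω r z hr
    simp (disch := fun_prop) only [pd_mul, pd_add, pd_coord] at h1
    rw [pd_comm hc 0 2] at h1
    simp at h1
    linear_combination r * h1 + r ^ 2 * h2 - h.continuity r z
  set D : ℝ → E3 → ℝ := fun r x => r⁻¹ * a x ^ 2 + r * (pd 0 a x ^ 2 + pd 2 a x ^ 2) with hD
  have hDc : ∀ r, Continuous (D r) := fun r => by fun_prop
  have hDnn : ∀ r, 0 < r → ∀ z, 0 ≤ D r (hp r z) := fun r hr z => by positivity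
  have hidentity : ∀ r, 0 < r → zint (pd 0 n) r = zint (D r) r := by
    intro r hr
    have h1 : zint (fun x => pd 0 n x + pd 2 m x) r = zint (D r) r := by
      refine zint_congr fun z => ?_
      have hl := laplace r z hr
      have e1 : pd 0 n (hp r z) = a (hp r z) * pd 0 a (hp r z) +
          r * (pd 0 a (hp r z) * pd 0 a (hp r z) + a (hp r z) * pd 0 (pd 0 a) (hp r z)) := by
        simp (disch := fun_prop) only [hn, pd_mul, pd_coord]
        simp
      have e2 : pd 2 m (hp r z) =
          r * (pd 2 a (hp r z) * pd 2 a (hp r z) + a (hp r z) * pd 2 (pd 2 a) (hp r z)) := by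
        simp (disch := fun_prop) only [hm, pd_mul, pd_coord]
        simp
      rw [e1, e2]
      simp only [hD]
      field_simp
      linear_combination a (hp r z) * hl
    rw [zint_add (by fun_prop) (by fun_prop), zint_pd_two hms hmper, add_zero] at h1
    exact h1
  have hF : ∀ r, 0 < r → HasDerivAt (zint n) (zint (D r) r) r := fun r hr =>
    (hasDerivAt_zint hns r).congr_deriv (hidentity r hr)
  have hF' : ∀ r, 0 < r → 0 ≤ zint (D r) r := fun r hr => zint_nonneg (hDnn r hr)
  have hψc : Continuous (zint fun x => max (merGradSq a c x - 1) 0) :=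
    continuous_zint (by fun_prop)
  have hle : ∀ r, 0 < r → zint n r ≤ 0 := by
    intro r hr
    refine nonpos_of_riccati (B := 0) (C := 448) (by norm_num) hF hF' hψc
      (fun s => zint_nonneg fun z => le_max_right _ _) hM ?_ hr
    intro s hs hψs
    have hs0 : 0 < s := by linarith
    have hG := h.zint_merGradSq_le hψs
    refine ⟨zint n s, by simp, ?_⟩
    have h1 : zint n s = s * zint (fun x => a x * pd 0 a x) s := by
      rw [← zint_const_mul]
      exact zint_congr fun z => by simp [hn]
    have h2 := zint_mul_sq_le hac ha0 s
    have h3 : zint (fun x => a x ^ 2) s ≤ 448 := by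
      have : zint (fun x => a x ^ 2) s ≤ zint (fun _ => 64) s :=
        zint_mono (by fun_prop) (by fun_prop) fun z hz => by
          have := h.abs_a_le hs0 hG hz
          nlinarith [sq_abs (a (hp s z)), abs_nonneg (a (hp s z))]
      rw [zint_const] at this
      linarith [pi_lt_d2]
    have h4 : s * zint (fun x => pd 0 a x ^ 2) s ≤ zint (D s) s := by
      rw [← zint_const_mul]
      refine zint_mono (by fun_prop) (hDc s) fun z _ => ?_
      simp only [hD]
      have e1 : 0 ≤ s⁻¹ * a (hp s z) ^ 2 := by positivity
      have e2 : 0 ≤ s * pd 2 a (hp s z) ^ 2 := by positivity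
      linarith
    have h0 : 0 ≤ zint (fun x => pd 0 a x ^ 2) s := zint_nonneg fun z => sq_nonneg _
    have h5 : zint (fun x => a x * pd 0 a x) s ^ 2 ≤ 448 * zint (fun x => pd 0 a x ^ 2) s :=
      h2.trans (mul_le_mul_of_nonneg_right h3 h0)
    rw [h1, mul_pow]
    calc s ^ 2 * zint (fun x => a x * pd 0 a x) s ^ 2
        ≤ s ^ 2 * (448 * zint (fun x => pd 0 a x ^ 2) s) := by gcongr
      _ = 448 * s * (s * zint (fun x => pd 0 a x ^ 2) s) := by ring
      _ ≤ 448 * s * zint (D s) s := by gcongr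
  have hmono : MonotoneOn (zint n) (Ici 0) := by
    refine monotoneOn_of_deriv_nonneg (convex_Ici 0)
      (continuous_zint hns.continuous).continuousOn ?_ ?_
    · intro x hx
      exact (hasDerivAt_zint hns x).differentiableAt.differentiableWithinAt
    · intro x hx
      rw [interior_Ici] at hx
      rw [(hF x hx).deriv]
      exact hF' x hx
  have hzero : zint n 0 = 0 := by
    rw [zint_congr (g := fun _ => (0 : ℝ)) (fun z => by simp [hn]), zint_const, mul_zero]
  have hF0 : ∀ r, 0 < r → zint n r = 0 := fun r hr =>
    le_antisymm (hle r hr) (hzero ▸ hmono (mem_Ici.2 le_rfl) (mem_Ici.2 hr.le) hr.le)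
  have hD0 : zint (D r) r = 0 := by
    have h1 : zint n =ᶠ[𝓝 r] fun _ => 0 := by
      filter_upwards [lt_mem_nhds hr] with s hs using hF0 s hs
    exact (hF r hr).unique ((hasDerivAt_const r (0 : ℝ)).congr_of_eventuallyEq h1)
  have hDper : ZPer (D r) := by
    intro x
    simp only [hD]
    rw [h.per_a x, (h.per_a.pd 2) x, (h.per_a.pd 0) x]
  have hpt := eq_zero_of_zint_eq_zero (hDc r) hDper (hDnn r hr) hD0 z
  simp only [hD] at hpt
  have e1 : 0 ≤ r⁻¹ * a (hp r z) ^ 2 := by positivity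
  have e2 : 0 ≤ r * (pd 0 a (hp r z) ^ 2 + pd 2 a (hp r z) ^ 2) := by positivity
  have e3 : r⁻¹ * a (hp r z) ^ 2 = 0 := by linarith
  simpa [hr.ne'] using e3

theorem c_eq_const {M : ℝ}
    (hM : ∀ T, 1 ≤ T → ∫ r in (1 : ℝ)..T, zint (fun x => max (merGradSq a c x - 1) 0) r ≤ M)
    {r : ℝ} (hr : 0 ≤ r) (z : ℝ) : c (hp r z) = c (hp 1 0) := by
  have hc := h.smooth_c
  have hcc := hc.continuous
  have ha0 : ∀ r z, 0 < r → a (hp r z) = 0 := fun r z hr => h.a_eq_zero hM hr z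
  have hc2 : ∀ r z, 0 < r → pd 2 c (hp r z) = 0 := by
    intro r z hr
    have h1 := h.continuity r z
    rw [ha0 r z hr, pd_zero_of_eq_zero h.smooth_a ha0 hr] at h1
    simpa [hr.ne'] using h1
  have hc0 : ∀ r z, 0 < r → pd 0 c (hp r z) = 0 := by
    intro r z hr
    have h1 := h.ω_eq (hp r z)
    rw [h.ω_eq_zero hM hr, pd_two_of_eq_zero h.smooth_a (fun z => ha0 r z hr)] at h1
    linarith
  have hpos : ∀ r, 0 < r → c (hp r z) = c (hp 1 0) := by
    intro r hr
    have h1 : c (hp r z) = c (hp r 0) :=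
      is_const_of_deriv_eq_zero (fun s => (hasDerivAt_hp_right hc r s).differentiableAt)
        (fun s => by rw [(hasDerivAt_hp_right hc r s).deriv, hc2 r s hr]) z 0
    rw [h1]
    exact isOpen_Ioi.is_const_of_deriv_eq_zero isPreconnected_Ioi
      (f := fun s => c (hp s 0)) (s := Ioi 0)
      (fun s _ => (hasDerivAt_hp_left hc s 0).differentiableAt.differentiableWithinAt)
      (fun s hs => by rw [(hasDerivAt_hp_left hc s 0).deriv, hc0 s 0 hs]; rfl) hr
      (mem_Ioi.2 one_pos)
  have hclosed : IsClosed {s | c (hp s z) = c (hp 1 0)} :=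
    isClosed_eq (by fun_prop) continuous_const
  have hsub : Ici (0 : ℝ) ⊆ {s | c (hp s z) = c (hp 1 0)} := by
    rw [← closure_Ioi]
    exact closure_minimal hpos hclosed
  exact hsub hr

end MeridianFlow

/-! ### The Dirichlet integral in cylindrical coordinates -/

theorem lintegral_axisymmetric {k : ℝ → ℝ → ENNReal} (hk : Measurable fun p : ℝ × ℝ => k p.1 p.2) :
    ∫⁻ x : E3, k (rr x) (x 2) =
      ∫⁻ z : ℝ, ENNReal.ofReal (2 * π) * ∫⁻ r in Ioi (0 : ℝ), ENNReal.ofReal r * k r z := by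
  have hm : Measurable fun p : ℝ × (Fin 2 → ℝ) => k (√(p.2 0 ^ 2 + p.2 1 ^ 2)) p.1 :=
    hk.comp (f := fun p : ℝ × (Fin 2 → ℝ) => (√(p.2 0 ^ 2 + p.2 1 ^ 2), p.1))
      (by fun_prop : Continuous fun p : ℝ × (Fin 2 → ℝ) =>
        (√(p.2 0 ^ 2 + p.2 1 ^ 2), p.1)).measurable
  rw [← (PiLp.volume_preserving_toLp (Fin 3)).lintegral_comp_emb
      (MeasurableEquiv.toLp 2 (Fin 3 → ℝ)).measurableEmbedding,
    ← ((volume_preserving_piFinSuccAbove (fun _ : Fin 3 => ℝ) 2).symm _).lintegral_comp_emb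
      (MeasurableEquiv.measurableEmbedding _)]
  have e : ∀ p : ℝ × (Fin 2 → ℝ),
      k (rr (WithLp.toLp 2 ((MeasurableEquiv.piFinSuccAbove (fun _ : Fin 3 => ℝ) 2).symm p)))
        (WithLp.toLp 2 ((MeasurableEquiv.piFinSuccAbove (fun _ : Fin 3 => ℝ) 2).symm p) 2) =
      k (√(p.2 0 ^ 2 + p.2 1 ^ 2)) p.1 := by
    rintro ⟨z, w⟩
    rfl
  simp only [e]
  rw [Measure.volume_eq_prod, lintegral_prod _ hm.aemeasurable]
  refine lintegral_congr fun z => ?_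
  rw [← ((volume_preserving_finTwoArrow ℝ).symm _).lintegral_comp_emb
      (MeasurableEquiv.measurableEmbedding _), ← lintegral_comp_polarCoord_symm]
  have hz : Measurable fun r => k r z := hk.comp (measurable_id.prodMk measurable_const)
  have hmz : Measurable fun p : ℝ × ℝ => ENNReal.ofReal p.1 * k p.1 z :=
    (ENNReal.measurable_ofReal.comp measurable_fst).mul (hz.comp measurable_fst)
  have e2 : ∀ p ∈ polarCoord.target, ENNReal.ofReal p.1 •
      k (√((MeasurableEquiv.finTwoArrow.symm (polarCoord.symm p) : Fin 2 → ℝ) 0 ^ 2 +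
        (MeasurableEquiv.finTwoArrow.symm (polarCoord.symm p) : Fin 2 → ℝ) 1 ^ 2)) z =
      ENNReal.ofReal p.1 * k p.1 z := by
    rintro ⟨r, θ⟩ hp
    have hr : 0 < r := hp.1
    have : (r * cos θ) ^ 2 + (r * sin θ) ^ 2 = r ^ 2 := by
      rw [mul_pow, mul_pow, ← mul_add, cos_sq_add_sin_sq, mul_one]
    simp [MeasurableEquiv.finTwoArrow, polarCoord_symm_apply, this, sqrt_sq hr.le]
  rw [setLIntegral_congr_fun polarCoord.open_target.measurableSet e2, polarCoord_target,
    Measure.volume_eq_prod, ← Measure.prod_restrict, lintegral_prod _ hmz.aemeasurable]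
  simp only [lintegral_const, Measure.restrict_apply MeasurableSet.univ, univ_inter,
    Real.volume_Ioo]
  rw [lintegral_mul_const _ (by fun_prop), mul_comm]
  congr 2
  ring

theorem max_sub_one_le_rpow {s q : ℝ} (hs : 0 ≤ s) (hq : 2 ≤ q) : max (s - 1) 0 ≤ s ^ (q / 2) := by
  refine max_le ?_ (rpow_nonneg hs _)
  rcases le_total s 1 with h1 | h1
  · linarith [rpow_nonneg hs (q / 2)]
  · have := rpow_le_rpow_of_exponent_le h1 (by linarith : (1 : ℝ) ≤ q / 2)
    rw [rpow_one] at this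
    linarith

/-- Bound for the truncated meridian gradient in terms of an axisymmetric integral over the slab. -/
theorem integral_zint_le {g : E3 → ℝ} (hg : Continuous g) (hg0 : ∀ x, 0 ≤ g x)
    (hfin : ∫⁻ x : E3 in {x : E3 | x 2 ∈ Icc (-π) π}, ENNReal.ofReal (g (hp (rr x) (x 2))) < ⊤)
    (T : ℝ) (hT : 1 ≤ T) :
    ∫ r in (1 : ℝ)..T, zint g r ≤
      (∫⁻ x : E3 in {x : E3 | x 2 ∈ Icc (-π) π}, ENNReal.ofReal (g (hp (rr x) (x 2)))).toReal := by
  have hS : MeasurableSet {x : E3 | x 2 ∈ Icc (-π) π} :=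
    (by fun_prop : Continuous fun x : E3 => x 2).measurable measurableSet_Icc
  have hpi : -π ≤ π := by linarith [pi_pos]
  have hgm : Measurable fun p : ℝ × ℝ => ENNReal.ofReal (g (hp p.1 p.2)) :=
    ENNReal.measurable_ofReal.comp (by fun_prop : Continuous fun p : ℝ × ℝ => g (hp p.1 p.2)).measurable
  set k : ℝ → ℝ → ENNReal := fun r z =>
    (Icc (-π) π).indicator (fun z => ENNReal.ofReal (g (hp r z))) z with hk
  have hkm : Measurable fun p : ℝ × ℝ => k p.1 p.2 :=
    hgm.indicator (measurable_snd measurableSet_Icc : MeasurableSet {p : ℝ × ℝ | p.2 ∈ Icc (-π) π})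
  have h1 : ∫⁻ x : E3 in {x : E3 | x 2 ∈ Icc (-π) π}, ENNReal.ofReal (g (hp (rr x) (x 2))) =
      ∫⁻ x : E3, k (rr x) (x 2) := by
    rw [← lintegral_indicator hS]
    rfl
  rw [← ENNReal.ofReal_le_iff_le_toReal hfin.ne, h1, lintegral_axisymmetric hkm,
    intervalIntegral.integral_of_le hT,
    ofReal_integral_eq_lintegral_ofReal ((continuous_zint hg).integrableOn_Ioc)
      (Eventually.of_forall fun r => zint_nonneg fun z => hg0 _)]
  have h2 : ∀ r, ENNReal.ofReal (zint g r) =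
      ∫⁻ z in Ioc (-π) π, ENNReal.ofReal (g (hp r z)) := by
    intro r
    unfold zint
    rw [intervalIntegral.integral_of_le hpi, ofReal_integral_eq_lintegral_ofReal
      (Continuous.integrableOn_Ioc (by fun_prop)) (Eventually.of_forall fun z => hg0 _)]
  simp only [h2]
  rw [lintegral_lintegral_swap hgm.aemeasurable, ← lintegral_indicator measurableSet_Ioc]
  refine lintegral_mono fun z => ?_
  by_cases hz : z ∈ Ioc (-π) π
  · rw [indicator_of_mem hz]
    have h2π : 1 ≤ ENNReal.ofReal (2 * π) := by
      rw [ENNReal.one_le_ofReal]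
      linarith [pi_gt_three]
    refine le_trans ?_ (le_mul_of_one_le_left zero_le h2π)
    calc ∫⁻ r in Ioc 1 T, ENNReal.ofReal (g (hp r z))
        ≤ ∫⁻ r in Ioc 1 T, ENNReal.ofReal r * k r z := by
          refine setLIntegral_mono' measurableSet_Ioc fun r hr => ?_
          simp only [hk, indicator_of_mem (Ioc_subset_Icc_self hz)]
          exact le_mul_of_one_le_left zero_le (ENNReal.one_le_ofReal.2 hr.1.le)
      _ ≤ ∫⁻ r in Ioi (0 : ℝ), ENNReal.ofReal r * k r z :=
          lintegral_mono_set fun r hr => mem_Ioi.2 (one_pos.trans hr.1)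
  · rw [indicator_of_notMem hz]
    exact zero_le

theorem AxisymNoSwirlNSWholeSlab.axisymComponents {v : E3 → E3} {p : E3 → ℝ}
    {vr vz : ℝ → ℝ → ℝ} (hsol : AxisymNoSwirlNSWholeSlab v p vr vz) :
    AxisymComponents (fun x => v x 0) (fun x => v x 1) (fun x => v x 2) := by
  have hv := hsol.smooth_v
  have hax := hsol.axisym_no_swirl
  refine ⟨by fun_prop, by fun_prop, by fun_prop, fun r θ z => ?_, fun r θ z => ?_, fun r θ z => ?_⟩
  · simp only [(hax _).1, rr_cyl, rr_hp, cyl_zero, cyl_two, hp_zero, hp_two]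
    ring
  · simp only [(hax _).1, (hax _).2.1, rr_cyl, rr_hp, cyl_one, cyl_two, hp_zero, hp_two]
    ring
  · simp only [(hax _).2.2, rr_cyl, rr_hp, cyl_two, hp_two]

theorem AxisymNoSwirlNSWholeSlab.meridianFlow {v : E3 → E3} {p : E3 → ℝ}
    {vr vz : ℝ → ℝ → ℝ} (hsol : AxisymNoSwirlNSWholeSlab v p vr vz) :
    MeridianFlow (fun x => v x 0) (fun x => v x 2)
      (fun x => pd 2 (fun x => v x 0) x - pd 0 (fun x => v x 2) x) := by
  refine hsol.axisymComponents.meridianFlow hsol.smooth_p (fun x => ?_) (fun x => ?_)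
    (fun x => ?_) (fun x => ?_) (fun x => ?_)
  · exact congrArg (fun w => w 0) (hsol.periodic x)
  · exact congrArg (fun w => w 2) (hsol.periodic x)
  · simpa only [Fin.sum_univ_three] using hsol.momentum x 0
  · simpa only [Fin.sum_univ_three] using hsol.momentum x 2
  · simpa only [Fin.sum_univ_three] using hsol.incompressible x

theorem AxisymNoSwirlNSWholeSlab.merGradSq_le {v : E3 → E3} {p : E3 → ℝ}
    {vr vz : ℝ → ℝ → ℝ} (hsol : AxisymNoSwirlNSWholeSlab v p vr vz) (x : E3) :
    merGradSq (fun x => v x 0) (fun x => v x 2) (hp (rr x) (x 2)) ≤ gradSq3 v x := by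
  obtain ⟨r, θ, z, hr, rfl⟩ := exists_eq_cyl x
  rw [rr_cyl, cyl_two, abs_of_nonneg hr]
  simp only [gradSq3, Fin.sum_univ_three]
  exact hsol.axisymComponents.meridian_gradient_le r θ z

/-- the Liouville-type Theorem 1.3 — a smooth axisymmetric
no-swirl solution in `ℝ² × S¹` with finite generalized Dirichlet integral is a
constant vector field. -/
theorem liouville_slab (q : ℝ) (hq : 2 ≤ q)
    (v : E3 → E3) (p : E3 → ℝ) (vr vz : ℝ → ℝ → ℝ)
    (hsol : AxisymNoSwirlNSWholeSlab v p vr vz)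
    (hdiri : ∫⁻ x : E3 in {x : E3 | x 2 ∈ Icc (-π) π},
      ENNReal.ofReal ((gradSq3 v x) ^ (q / 2)) < ⊤) :
    ∃ c : E3, ∀ x : E3, v x = c := by
  have h := hsol.meridianFlow
  set g : E3 → ℝ := fun x => max (merGradSq (fun x => v x 0) (fun x => v x 2) x - 1) 0 with hg
  have hgc : Continuous g := by
    have := h.continuous_merGradSq
    fun_prop
  have hfin : ∫⁻ x : E3 in {x : E3 | x 2 ∈ Icc (-π) π},
      ENNReal.ofReal (g (hp (rr x) (x 2))) < ⊤ := by
    refine lt_of_le_of_lt (lintegral_mono fun x => ENNReal.ofReal_le_ofReal ?_) hdiri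
    have h0 : 0 ≤ gradSq3 v x :=
      Finset.sum_nonneg fun i _ => Finset.sum_nonneg fun j _ => sq_nonneg _
    refine le_trans ?_ (max_sub_one_le_rpow h0 hq)
    exact max_le_max_right _ (sub_le_sub_right (hsol.merGradSq_le x) 1)
  have hM := integral_zint_le hgc (fun x => le_max_right _ _) hfin
  have ha : ∀ r z, 0 ≤ r → v (hp r z) 0 = 0 := fun r z hr => by
    rcases hr.eq_or_lt with rfl | hr
    · exact hsol.axisymComponents.a_axis z
    · exact h.a_eq_zero hM hr z
  refine ⟨v (hp 1 0), fun x => ?_⟩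
  obtain ⟨r, θ, z, hr, rfl⟩ := exists_eq_cyl x
  ext i
  fin_cases i
  · exact (hsol.axisymComponents.cyl_a r θ z).trans (by simp [ha, hr])
  · exact (hsol.axisymComponents.cyl_b r θ z).trans
      (by simp [ha, hr, hsol.axisymComponents.b_hp])
  · exact (hsol.axisymComponents.cyl_c r θ z).trans (h.c_eq_const hM hr z)
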